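/- arXiv:0905.3140 — 2 statements merged into one kernel-verified Lean document; each statement's English description precedes it below -/
import Mathlib

section
/- Let d ≥ 1 be an integer, let f : ℝ^d → ℂ be a Schwartz function, and let s ∈ ℂ with 0 < Re(s) < d/2. Then the functions x ↦ 𝓕f(x)·|x|^{-2s} and x ↦ f(x)·|x|^{2s-d} are both Lebesgue integrable on ℝ^d, and π^{-s} Γ(s) ∫_{ℝ^d} 𝓕f(x) |x|^{-2s} dx = π^{s - d/2} Γ(d/2 - s) ∫_{ℝ^d} f(x) |x|^{2s-d} dx. -/
open MeasureTheory Real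
open scoped FourierTransform

/-- local integrability of the power of the norm, damped by a Schwartz function -/
lemma aux_integrable (d : ℕ) (hd : 1 ≤ d)
    (g : SchwartzMap (EuclideanSpace ℝ (Fin d)) ℂ) (w : ℂ) (hw0 : w.re < 0)
    (hwd : -(d : ℝ) < w.re) :
    Integrable (fun x : EuclideanSpace ℝ (Fin d) => g x * ((‖x‖ : ℂ) ^ w)) := by
  have : Nonempty (Fin d) := ⟨⟨0, hd⟩⟩
  have hball : IntegrableOn (fun x : EuclideanSpace ℝ (Fin d) => ‖x‖ ^ w.re)
      (Metric.ball 0 1) := by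
    rw [integrableOn_fun_norm_addHaar volume (f := fun r : ℝ => r ^ w.re)]
    have h1 : IntegrableOn (fun y : ℝ => y ^ ((d : ℝ) - 1 + w.re)) (Set.Ioo 0 1) := by
      rw [intervalIntegral.integrableOn_Ioo_rpow_iff one_pos]
      linarith
    refine h1.congr_fun (fun y hy => ?_) measurableSet_Ioo
    have hy0 : 0 < y := hy.1
    simp only [finrank_euclideanSpace, Fintype.card_fin, smul_eq_mul]
    rw [Real.rpow_add hy0, ← Real.rpow_natCast, Nat.cast_sub hd, Nat.cast_one]
  obtain ⟨C, hC⟩ : ∃ C, ∀ x, ‖g x‖ ≤ C := by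
    obtain ⟨C, hC⟩ := g.decay 0 0
    exact ⟨C, fun x => by simpa using hC.2 x⟩
  have hbd : Integrable (fun x : EuclideanSpace ℝ (Fin d) =>
      C * (Metric.ball 0 1).indicator (fun x => ‖x‖ ^ w.re) x + ‖g x‖) :=
    ((hball.integrable_indicator measurableSet_ball).const_mul C).add g.integrable.norm
  refine hbd.mono' ?_ (Filter.Eventually.of_forall fun x => ?_)
  · refine g.continuous.aestronglyMeasurable.mul ?_
    exact Measurable.aestronglyMeasurable (by fun_prop)
  · rw [norm_mul, Complex.norm_cpow_eq_rpow_re_of_nonneg (norm_nonneg x) hw0.ne]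
    by_cases hx : x ∈ Metric.ball (0 : EuclideanSpace ℝ (Fin d)) 1
    · rw [Set.indicator_of_mem hx]
      have := mul_le_mul_of_nonneg_right (hC x) (Real.rpow_nonneg (norm_nonneg x) w.re)
      linarith [norm_nonneg (g x)]
    · rw [Set.indicator_of_notMem hx]
      have h1 : 1 ≤ ‖x‖ := by simpa using hx
      have := mul_le_mul_of_nonneg_left (Real.rpow_le_one_of_one_le_of_nonpos h1 hw0.le)
        (norm_nonneg (g x))
      linarith

lemma aux_pow {r : ℝ} (hr : 0 < r) (a : ℂ) :
    (1 / ((π * r ^ 2 : ℝ) : ℂ)) ^ a = (π : ℂ) ^ (-a) * (r : ℂ) ^ (-2 * a) := by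
  have h2 : (0 : ℝ) < π * r ^ 2 := by positivity
  rw [one_div, Complex.inv_cpow _ _ (by rw [Complex.arg_ofReal_of_nonneg h2.le]; exact pi_pos.ne),
    ← Complex.cpow_neg, Complex.ofReal_mul, Complex.mul_cpow_ofReal_nonneg pi_pos.le (by positivity)]
  congr 1
  rw [pow_two, Complex.ofReal_mul, Complex.mul_cpow_ofReal_nonneg hr.le hr.le,
    ← Complex.cpow_add _ _ (by exact_mod_cast hr.ne')]
  congr 1; ring

lemma aux_mellin (d : ℕ) (hd : 1 ≤ d)
    (g : SchwartzMap (EuclideanSpace ℝ (Fin d)) ℂ) (a : ℂ) (ha0 : 0 < a.re)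
    (had : a.re < (d : ℝ) / 2) :
    mellin (fun t : ℝ => ∫ x : EuclideanSpace ℝ (Fin d),
      g x * Complex.exp (-((π * ‖x‖ ^ 2 : ℝ) * t : ℂ))) a
    = (π : ℂ) ^ (-a) * Complex.Gamma a *
        ∫ x : EuclideanSpace ℝ (Fin d), g x * ((‖x‖ : ℂ) ^ (-2 * a)) := by
  have : Nonempty (Fin d) := ⟨⟨0, hd⟩⟩
  have hI := aux_integrable d hd g (-2 * a) (by simpa using ha0) (by simp; linarith)
  have hne : ∀ᵐ x : EuclideanSpace ℝ (Fin d), x ≠ 0 := by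
    simp [ae_iff]
  let F : EuclideanSpace ℝ (Fin d) → ℝ → ℂ := fun x t =>
    g x * ((t : ℂ) ^ (a - 1) * Complex.exp (-((π * ‖x‖ ^ 2 : ℝ) * t : ℂ)))
  have hnorm : ∀ x, ∀ t ∈ Set.Ioi (0 : ℝ), ‖F x t‖ =
      ‖g x‖ * (t ^ (a.re - 1) * Real.exp (-((π * ‖x‖ ^ 2) * t))) := by
    intro x t ht
    simp only [F, norm_mul]
    rw [Complex.norm_cpow_eq_rpow_re_of_pos ht, Complex.norm_exp]
    simp [← Complex.ofReal_pow]
  have hmeas : AEStronglyMeasurable (Function.uncurry F)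
      ((volume : Measure (EuclideanSpace ℝ (Fin d))).prod (volume.restrict (Set.Ioi (0 : ℝ)))) := by
    have hg : Measurable g := g.continuous.measurable
    exact Measurable.aestronglyMeasurable (by simp only [F, Function.uncurry_def]; fun_prop)
  have hint : Integrable (Function.uncurry F)
      ((volume : Measure (EuclideanSpace ℝ (Fin d))).prod (volume.restrict (Set.Ioi (0 : ℝ)))) := by
    rw [integrable_prod_iff hmeas]
    constructor
    · filter_upwards [hne] with x hx
      have hx' : 0 < π * ‖x‖ ^ 2 := by have := norm_pos_iff.2 hx; positivity
      have h1 := (integrableOn_rpow_mul_exp_neg_mul_rpow (s := a.re - 1) (p := 1) (by linarith)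
        one_pos hx').const_mul ‖g x‖
      refine Integrable.mono' h1 ?_ ?_
      · exact Measurable.aestronglyMeasurable (by simp only [F, Function.uncurry_def]; fun_prop)
      · filter_upwards [ae_restrict_mem measurableSet_Ioi] with t ht
        have := hnorm x t ht
        simp only [Function.uncurry_apply_pair]
        rw [this]
        simp
    · have h2 := hI.norm.const_mul (π ^ (-a.re) * Real.Gamma a.re)
      refine h2.congr ?_
      filter_upwards [hne] with x hx
      have hx0 := norm_pos_iff.2 hx
      have hx' : 0 < π * ‖x‖ ^ 2 := by positivity
      simp only [Function.uncurry_apply_pair]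
      rw [setIntegral_congr_fun measurableSet_Ioi (hnorm x), integral_const_mul,
        Real.integral_rpow_mul_exp_neg_mul_Ioi ha0 hx', norm_mul,
        Complex.norm_cpow_eq_rpow_re_of_pos hx0]
      have h3 : (1 / (π * ‖x‖ ^ 2)) ^ a.re = π ^ (-a.re) * ‖x‖ ^ (-2 * a.re) := by
        rw [one_div, Real.inv_rpow hx'.le, ← Real.rpow_neg hx'.le,
          Real.mul_rpow pi_pos.le (by positivity), ← Real.rpow_natCast, ← Real.rpow_mul hx0.le]
        congr 2
        push_cast; ring
      rw [h3]
      simp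
      ring
  have hswap := integral_integral_swap hint
  calc _ = ∫ t in Set.Ioi (0 : ℝ), ∫ x, F x t := by
        simp only [mellin, smul_eq_mul, F, ← integral_const_mul]
        congr 1; ext t; congr 1; ext x; ring
    _ = ∫ x, ∫ t in Set.Ioi (0 : ℝ), F x t := hswap.symm
    _ = _ := by
        rw [← integral_const_mul]
        refine integral_congr_ae ?_
        filter_upwards [hne] with x hx
        have hx0 := norm_pos_iff.2 hx
        have hx' : 0 < π * ‖x‖ ^ 2 := by positivity
        simp only [F]
        rw [integral_const_mul, Complex.integral_cpow_mul_exp_neg_mul_Ioi ha0 hx', aux_pow hx0]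
        ring

lemma aux_gauss (d : ℕ) (f : SchwartzMap (EuclideanSpace ℝ (Fin d)) ℂ) (t : ℝ) (ht : 0 < t) :
    ∫ x : EuclideanSpace ℝ (Fin d), 𝓕 (⇑f) x * Complex.exp (-((π * ‖x‖ ^ 2 : ℝ) * t : ℂ))
    = (t : ℂ) ^ (-(d : ℂ) / 2) * ∫ x : EuclideanSpace ℝ (Fin d),
        f x * Complex.exp (-((π * ‖x‖ ^ 2 : ℝ) * (t⁻¹ : ℝ) : ℂ)) := by
  have hb : 0 < ((π * t : ℝ) : ℂ).re := by rw [Complex.ofReal_re]; positivity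
  have J : Integrable (fun v : EuclideanSpace ℝ (Fin d) =>
      Complex.exp (-((π * t : ℝ) : ℂ) * ‖v‖ ^ 2)) := by
    simpa using GaussianFourier.integrable_cexp_neg_mul_sq_norm_add hb 0
      (0 : EuclideanSpace ℝ (Fin d))
  have h := VectorFourier.integral_fourierIntegral_smul_eq_flip
    (L := innerₗ (EuclideanSpace ℝ (Fin d))) (μ := volume) (ν := volume)
      Real.continuous_fourierChar continuous_inner f.integrable J
  have h' : ∫ x : EuclideanSpace ℝ (Fin d), 𝓕 (⇑f) x *
      Complex.exp (-((π * t : ℝ) : ℂ) * ‖x‖ ^ 2) =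
      ∫ x : EuclideanSpace ℝ (Fin d), f x *
        𝓕 (fun v : EuclideanSpace ℝ (Fin d) =>
          Complex.exp (-((π * t : ℝ) : ℂ) * ‖v‖ ^ 2)) x := by
    simpa using! h
  calc _ = _ := by
        congr 1; ext x; congr 2; push_cast; ring
    _ = _ := h'
    _ = _ := by
        rw [← integral_const_mul]
        congr 1; ext x
        rw [fourier_gaussian_innerProductSpace hb]
        have hpi : (π : ℂ) ≠ 0 := by exact_mod_cast pi_ne_zero
        have ht' : (t : ℂ) ≠ 0 := by exact_mod_cast ht.ne'
        have e1 : (π : ℂ) / ((π * t : ℝ) : ℂ) = (t : ℂ)⁻¹ := by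
          push_cast; field_simp
        rw [e1, Complex.inv_cpow _ _
          (by rw [Complex.arg_ofReal_of_nonneg ht.le]; exact pi_pos.ne), ← Complex.cpow_neg]
        have e2 : -(π : ℂ) ^ 2 * (‖x‖ : ℂ) ^ 2 / ((π * t : ℝ) : ℂ)
            = -((π * ‖x‖ ^ 2 : ℝ) * (t⁻¹ : ℝ) : ℂ) := by
          push_cast; field_simp
        rw [e2]
        simp only [finrank_euclideanSpace, Fintype.card_fin, neg_div]
        ring

/-- Lemma 3.4 of the paper (functional equation), for the 2π-normalized Fourier transform:
`π^{-s} Γ(s) ∫ 𝓕f(x) |x|^{-2s} dx = π^{s-d/2} Γ(d/2-s) ∫ f(x) |x|^{2s-d} dx`. -/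
theorem functional_equation (d : ℕ) (hd : 1 ≤ d)
    (f : SchwartzMap (EuclideanSpace ℝ (Fin d)) ℂ)
    (s : ℂ) (hs0 : 0 < s.re) (hsd : s.re < (d : ℝ) / 2) :
    Integrable (fun x : EuclideanSpace ℝ (Fin d) =>
        𝓕 (⇑f) x * ((‖x‖ : ℂ) ^ (-2 * s))) ∧
    Integrable (fun x : EuclideanSpace ℝ (Fin d) =>
        f x * ((‖x‖ : ℂ) ^ (2 * s - (d : ℂ)))) ∧
    (π : ℂ) ^ (-s) * Complex.Gamma s *
        ∫ x : EuclideanSpace ℝ (Fin d), 𝓕 (⇑f) x * ((‖x‖ : ℂ) ^ (-2 * s))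
      = (π : ℂ) ^ (s - (d : ℂ) / 2) * Complex.Gamma ((d : ℂ) / 2 - s) *
        ∫ x : EuclideanSpace ℝ (Fin d), f x * ((‖x‖ : ℂ) ^ (2 * s - (d : ℂ))) := by
  have hre : ((d : ℂ) / 2 - s).re = (d : ℝ) / 2 - s.re := by simp
  refine ⟨aux_integrable d hd (𝓕 f) (-2 * s) (by simpa using hs0) (by simp; linarith),
    aux_integrable d hd f _ (by simp; linarith) (by simpa using hs0), ?_⟩
  have h1 := aux_mellin d hd (𝓕 f) s hs0 hsd
  have h2 := aux_mellin d hd f ((d : ℂ) / 2 - s) (by rw [hre]; linarith) (by rw [hre]; linarith)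
  rw [show -2 * ((d : ℂ) / 2 - s) = 2 * s - d by ring, neg_sub] at h2
  rw [← h2]
  refine h1.symm.trans ?_
  rw [show (d : ℂ) / 2 - s = -(s + -(d : ℂ) / 2) by ring, ← mellin_comp_inv, ← mellin_cpow_smul]
  refine setIntegral_congr_fun measurableSet_Ioi fun t ht => ?_
  simp only [smul_eq_mul]
  congr 1
  exact aux_gauss d f t ht
end

section
/- Let n ≥ 2, set d = n−1, let 0 < u < 1 be real, and let φ : ℝ^d → ℂ be a Schwartz function that is not identically zero. Then ∫_{ℝ^d} ( ∫_{ℝ^d} conj(φ(y)) φ(y+x) dy ) |x|^{-d(1-u)} dx is a strictly positive real number. -/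
open MeasureTheory Real
open scoped ComplexConjugate

open scoped FourierTransform in
lemma autocorr_exists {V : Type*} [NormedAddCommGroup V] [InnerProductSpace ℝ V]
    [FiniteDimensional ℝ V] [MeasurableSpace V] [BorelSpace V] (φ : SchwartzMap V ℂ) :
    ∃ A : SchwartzMap V ℂ, (∀ x, A x = ∫ y, conj (φ y) * φ (y + x)) ∧
      ∀ ξ, 𝓕 A ξ = ((‖𝓕 φ ξ‖ ^ 2 : ℝ) : ℂ) := by
  let ψ : SchwartzMap V ℂ := SchwartzMap.postcompCLM (𝕜 := ℝ) (Complex.conjCLE : ℂ →L[ℝ] ℂ)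
    (SchwartzMap.compCLMOfContinuousLinearEquiv ℝ (ContinuousLinearEquiv.neg ℝ : V ≃L[ℝ] V) φ)
  have hψ : ∀ x, ψ x = conj (φ (-x)) := fun x => by
    simp [ψ, SchwartzMap.postcompCLM_apply]
  refine ⟨SchwartzMap.convolution (ContinuousLinearMap.mul ℂ ℂ) ψ φ, fun x => ?_, fun ξ => ?_⟩
  · rw [SchwartzMap.convolution_apply, convolution_mul,
      ← integral_neg_eq_self]
    simp [hψ, add_comm]
  · rw [SchwartzMap.fourier_convolution_apply,
      Real.fourier_mul_convolution_eq ψ.integrable φ.integrable]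
    have h : 𝓕 (ψ : V → ℂ) ξ = conj (𝓕 (φ : V → ℂ) ξ) := by
      rw [Real.fourier_eq', Real.fourier_eq', ← integral_conj, ← integral_neg_eq_self]
      congr 1
      ext v
      simp [hψ, ← Complex.exp_conj, map_ofNat]
    rw [h, ← SchwartzMap.fourier_coe, mul_comm, Complex.mul_conj, Complex.normSq_eq_norm_sq]

open scoped FourierTransform in
lemma gauss_pairing_pos {V : Type*} [NormedAddCommGroup V] [InnerProductSpace ℝ V]
    [FiniteDimensional ℝ V] [MeasurableSpace V] [BorelSpace V] (φ A : SchwartzMap V ℂ)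
    (hφ : φ ≠ 0) (hA : ∀ ξ, 𝓕 A ξ = ((‖𝓕 φ ξ‖ ^ 2 : ℝ) : ℂ)) (t : ℝ) (ht : 0 < t) :
    ∃ c : ℝ, 0 < c ∧ ∫ x, A x * ((rexp (-(‖x‖ ^ 2 * t)) : ℝ) : ℂ) = c := by
  set b : ℝ := π ^ 2 / t with hb
  have hb0 : 0 < b := by positivity
  let g : V → ℂ := fun v => Complex.exp (-(b : ℂ) * ‖v‖ ^ 2)
  have hgi : Integrable g := by
    have := GaussianFourier.integrable_cexp_neg_mul_sq_norm_add (V := V) (b := (b : ℂ))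
      (by simpa using hb0) 0 0
    simpa [g] using this
  have hgr : ∀ v, g v = ((rexp (-b * ‖v‖ ^ 2) : ℝ) : ℂ) := fun v => by simp [g]
  set K : ℝ := (π / b) ^ ((Module.finrank ℝ V : ℝ) / 2) with hK
  have hK0 : 0 < K := by positivity
  have hF : ∀ w, 𝓕 g w = (K : ℂ) * ((rexp (-(‖w‖ ^ 2 * t)) : ℝ) : ℂ) := fun w => by
    rw [fourier_gaussian_innerProductSpace (by simpa using hb0), hK,
      Complex.ofReal_cpow (by positivity)]
    push_cast
    congr 2
    rw [hb]
    have : (π : ℂ) ≠ 0 := by exact_mod_cast pi_ne_zero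
    have : (t : ℂ) ≠ 0 := by exact_mod_cast ht.ne'
    push_cast
    field_simp
  have hpair : ∫ ξ, 𝓕 A ξ * g ξ = ∫ x, A x * 𝓕 g x := by
    simpa using! VectorFourier.integral_bilin_fourierIntegral_eq_flip
      (ContinuousLinearMap.mul ℂ ℂ) (L := innerₗ V)
      continuous_fourierChar continuous_inner A.integrable hgi
  set B : V → ℝ := fun ξ => ‖𝓕 φ ξ‖ ^ 2 * rexp (-b * ‖ξ‖ ^ 2) with hB
  have hBc : Continuous B := by
    have := (𝓕 φ).continuous
    fun_prop
  have hBC : ∀ ξ, 𝓕 A ξ * g ξ = (B ξ : ℂ) := fun ξ => by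
    rw [hA, hgr]; simp [hB]
  have hBi : Integrable B := by
    obtain ⟨C, hC⟩ := (𝓕 A).toBoundedContinuousFunction.isBounded_range.exists_norm_le
    have : Integrable (fun ξ => 𝓕 A ξ * g ξ) := by
      refine hgi.bdd_mul (c := C) (𝓕 A).continuous.aestronglyMeasurable (ae_of_all _ fun x => ?_)
      exact hC _ ⟨x, rfl⟩
    simp_rw [hBC] at this
    simpa using this.re
  have hne : 𝓕 φ ≠ 0 := by
    intro h
    apply hφ
    have := FourierTransform.fourierInv_fourier_eq (F := SchwartzMap V ℂ) φ
    rw [← this, h]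
    ext x
    simp
  obtain ⟨ξ, hξ⟩ : ∃ ξ, 𝓕 φ ξ ≠ 0 := by
    by_contra! h
    exact hne (by ext x; simpa using h x)
  have hpos : 0 < ∫ ξ, B ξ := by
    refine integral_pos_of_integrable_nonneg_nonzero (x := ξ) hBc hBi
      (fun ξ => by positivity) ?_
    exact (mul_pos (pow_pos (norm_pos_iff.2 hξ) 2) (exp_pos _)).ne'
  refine ⟨K⁻¹ * ∫ ξ, B ξ, mul_pos (inv_pos.2 hK0) hpos, ?_⟩
  simp_rw [hBC, hF] at hpair
  rw [integral_complex_ofReal] at hpair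
  have : ∀ x, A x * ((K : ℂ) * ((rexp (-(‖x‖ ^ 2 * t)) : ℝ) : ℂ)) =
    (K : ℂ) * (A x * ((rexp (-(‖x‖ ^ 2 * t)) : ℝ) : ℂ)) := fun x => by ring
  simp_rw [this] at hpair
  rw [integral_const_mul] at hpair
  rw [Complex.ofReal_mul, Complex.ofReal_inv, hpair, inv_mul_cancel_left₀ (by exact_mod_cast hK0.ne')]

lemma riesz_integrable {V : Type*} [NormedAddCommGroup V] [InnerProductSpace ℝ V]
    [FiniteDimensional ℝ V] [MeasurableSpace V] [BorelSpace V] (A : SchwartzMap V ℂ)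
    (hd : 1 ≤ Module.finrank ℝ V) (a : ℝ) (ha0 : 0 < a) (ha : a < Module.finrank ℝ V) :
    Integrable (fun x : V => ‖A x‖ * ‖x‖ ^ (-a)) := by
  obtain ⟨C, hC⟩ := A.toBoundedContinuousFunction.isBounded_range.exists_norm_le
  have hm : AEStronglyMeasurable (fun x : V => ‖A x‖ * ‖x‖ ^ (-a)) := by
    have := A.continuous.measurable
    exact Measurable.aestronglyMeasurable (by fun_prop)
  have h1 : IntegrableOn (fun x : V => ‖A x‖ * ‖x‖ ^ (-a)) (Metric.ball 0 1) := by
    refine integrableOn_ball_of_norm_le_rpow hd (C := C) ha (ae_of_all _ fun x => ?_) hm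
    rw [norm_of_nonneg (by positivity)]
    gcongr
    exact hC _ ⟨x, rfl⟩
  have h2 : IntegrableOn (fun x : V => ‖A x‖ * ‖x‖ ^ (-a)) (Metric.ball 0 1)ᶜ := by
    refine Integrable.mono' (A.integrable (μ := volume)).norm.integrableOn hm.restrict ?_
    filter_upwards [ae_restrict_mem (Metric.isOpen_ball.measurableSet.compl)] with x hx
    rw [norm_of_nonneg (by positivity)]
    have : 1 ≤ ‖x‖ := by simpa using hx
    exact mul_le_of_le_one_right (norm_nonneg _) (rpow_le_one_of_one_le_of_nonpos this (by linarith))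
  simpa using h1.union h2

lemma riesz_pos {V : Type*} [NormedAddCommGroup V] [InnerProductSpace ℝ V]
    [FiniteDimensional ℝ V] [MeasurableSpace V] [BorelSpace V] (φ : SchwartzMap V ℂ)
    (hφ : φ ≠ 0) (hd : 1 ≤ Module.finrank ℝ V) (a : ℝ) (ha0 : 0 < a)
    (ha : a < Module.finrank ℝ V) :
    ∃ c : ℝ, 0 < c ∧
      ∫ x : V, (∫ y : V, conj (φ y) * φ (y + x)) * (((‖x‖ ^ (-a)) : ℝ) : ℂ) = (c : ℂ) := by
  obtain ⟨A, hA, hFA⟩ := autocorr_exists φ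
  simp_rw [← hA]
  have hint := riesz_integrable A hd a ha0 ha
  have : Nontrivial V := Module.nontrivial_of_finrank_pos (R := ℝ) (by omega)
  have ha2 : 0 < a / 2 := by positivity
  have hG : 0 < Gamma (a / 2) := Gamma_pos_of_pos ha2
  let k : V → ℝ → ℝ := fun x t => t ^ (a / 2 - 1) * rexp (-(‖x‖ ^ 2 * t))
  have hk : ∀ x : V, x ≠ 0 → ∫ t in Set.Ioi 0, k x t = ‖x‖ ^ (-a) * Gamma (a / 2) := by
    intro x hx
    have hx' : 0 < ‖x‖ := norm_pos_iff.2 hx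
    simp only [k]
    rw [integral_rpow_mul_exp_neg_mul_Ioi ha2 (by positivity : 0 < ‖x‖ ^ 2)]
    congr 1
    rw [one_div, ← rpow_natCast, ← rpow_neg hx'.le, ← rpow_mul hx'.le]
    congr 1
    push_cast; ring
  have hki : ∀ x : V, x ≠ 0 → IntegrableOn (k x) (Set.Ioi 0) := by
    intro x hx
    have hx' : 0 < ‖x‖ := norm_pos_iff.2 hx
    refine Integrable.of_integral_ne_zero ?_
    rw [hk x hx]
    positivity
  have hk0 : ∀ x : V, ∀ t ∈ Set.Ioi (0:ℝ), 0 ≤ k x t := fun x t ht => by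
    have : 0 < t := ht
    positivity
  have hae : ∀ᵐ x : V, x ≠ 0 := by
    simp [ae_iff]
  have hFub : Integrable (fun p : V × ℝ => A p.1 * (k p.1 p.2 : ℂ))
      ((volume : Measure V).prod (volume.restrict (Set.Ioi 0))) := by
    have hm : AEStronglyMeasurable (fun p : V × ℝ => A p.1 * (k p.1 p.2 : ℂ))
      ((volume : Measure V).prod (volume.restrict (Set.Ioi 0))) := by
      have := A.continuous.measurable
      exact Measurable.aestronglyMeasurable (by fun_prop)
    rw [integrable_prod_iff hm]
    constructor
    · filter_upwards [hae] with x hx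
      exact (hki x hx).ofReal.const_mul _
    · refine (hint.mul_const (Gamma (a / 2))).congr ?_
      filter_upwards [hae] with x hx
      rw [mul_assoc, ← hk x hx, ← integral_const_mul]
      refine setIntegral_congr_fun measurableSet_Ioi fun t ht => ?_
      simp only [norm_mul, Complex.norm_real]
      rw [norm_of_nonneg (hk0 x t ht)]
  have hswap := integral_integral_swap (f := fun x t => A x * (k x t : ℂ)) hFub
  have hL : ∫ x, ∫ t in Set.Ioi 0, A x * (k x t : ℂ) =
      (∫ x, A x * ((‖x‖ ^ (-a) : ℝ) : ℂ)) * (Gamma (a / 2) : ℂ) := by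
    rw [← integral_mul_const]
    refine integral_congr_ae ?_
    filter_upwards [hae] with x hx
    rw [integral_const_mul, integral_complex_ofReal, hk x hx]
    push_cast; ring
  choose! c hc0 hc using fun t ht => gauss_pairing_pos φ A hφ hFA t ht
  have hin : ∀ t ∈ Set.Ioi (0:ℝ), ∫ x, A x * (k x t : ℂ) = ((t ^ (a / 2 - 1) * c t : ℝ) : ℂ) := by
    intro t ht
    push_cast
    rw [← hc t ht, ← integral_const_mul]
    congr 1; ext x
    simp only [k]; push_cast; ring
  have hR : IntegrableOn (fun t => t ^ (a / 2 - 1) * c t) (Set.Ioi 0) := by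
    have h := hFub.integral_prod_right.re
    refine h.congr ?_
    filter_upwards [ae_restrict_mem measurableSet_Ioi] with t ht
    simp only [hin t ht]
    simp
  rw [setIntegral_congr_fun measurableSet_Ioi hin, integral_complex_ofReal, hL] at hswap
  have hpp : ∀ t ∈ Set.Ioi (0:ℝ), 0 < t ^ (a / 2 - 1) * c t := fun t ht =>
    mul_pos (rpow_pos_of_pos ht _) (hc0 t ht)
  have hpos : 0 < ∫ t in Set.Ioi 0, t ^ (a / 2 - 1) * c t := by
    rw [setIntegral_pos_iff_support_of_nonneg_ae _ hR]
    · have : Function.support (fun t => t ^ (a / 2 - 1) * c t) ∩ Set.Ioi 0 = Set.Ioi 0 :=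
        Set.inter_eq_right.2 fun t ht => (hpp t ht).ne'
      rw [this]; simp
    · filter_upwards [ae_restrict_mem measurableSet_Ioi] with t ht
      exact (hpp t ht).le
  refine ⟨(∫ t in Set.Ioi 0, t ^ (a / 2 - 1) * c t) / Gamma (a / 2), by positivity, ?_⟩
  push_cast
  rw [← hswap, mul_div_cancel_right₀]
  exact Complex.ofReal_ne_zero.2 (ne_of_gt hG)

/-- The positive-definiteness assertion of Theorem 3.2 of the paper: for `0 < u < 1` the
`G`-invariant pairing `⟨φ, I(u)φ⟩` on the big Bruhat cell is strictly positive on nonzero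
Schwartz functions. -/
theorem pairing_positive_definite (n : ℕ) (hn : 2 ≤ n) (u : ℝ) (hu0 : 0 < u) (hu1 : u < 1)
    (φ : SchwartzMap (EuclideanSpace ℝ (Fin (n - 1))) ℂ) (hφ : φ ≠ 0) :
    ∃ c : ℝ, 0 < c ∧
      ∫ x : EuclideanSpace ℝ (Fin (n - 1)),
          (∫ y : EuclideanSpace ℝ (Fin (n - 1)), conj (φ y) * φ (y + x)) *
            (((‖x‖ ^ (-(((n : ℝ) - 1) * (1 - u)))) : ℝ) : ℂ) = (c : ℂ) := by
  have h2 : (2 : ℝ) ≤ n := by exact_mod_cast hn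
  refine riesz_pos φ hφ (by simp; omega) _ (mul_pos (by linarith) (by linarith)) ?_
  rw [finrank_euclideanSpace_fin, Nat.cast_sub (by omega)]
  push_cast
  nlinarith
end
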